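/- arXiv:2512.15078 — 12 statements merged into one kernel-verified Lean document; each statement's English description precedes it below -/
import Mathlib

section
/- Let R be a commutative ring with identity, S ⊆ R a multiplicatively closed subset, and J an ideal of R. Then R is S-J-Noetherian if and only if every prime ideal P of R that is a J-ideal and satisfies P ∩ S = ∅ is S-finite. -/
/-- `S` is a multiplicatively closed subset: `1 ∈ S` and `S` is closed under multiplication. -/
def MultClosed {R : Type*} [CommRing R] (S : Set R) : Prop :=
  1 ∈ S ∧ ∀ a ∈ S, ∀ b ∈ S, a * b ∈ S

/-- An ideal `I` is `S`-finite if there are `s ∈ S` and a finitely generated ideal `F`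
with `s • I ⊆ F ⊆ I`. -/
def SFinite {R : Type*} [CommRing R] (S : Set R) (I : Ideal R) : Prop :=
  ∃ s ∈ S, ∃ F : Ideal R, F.FG ∧ (∀ x ∈ I, s * x ∈ F) ∧ F ≤ I

/-- `R` is `S`-`J`-Noetherian if every `J`-ideal (an ideal not contained in `J`)
is `S`-finite. -/
def SJNoetherian {R : Type*} [CommRing R] (S : Set R) (J : Ideal R) : Prop :=
  ∀ I : Ideal R, ¬ I ≤ J → SFinite S I

/-- `R` is `S`-Noetherian if every ideal of `R` is `S`-finite. -/
def SNoetherian {R : Type*} [CommRing R] (S : Set R) : Prop :=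
  ∀ I : Ideal R, SFinite S I

/-- An ideal that meets `S` is `S`-finite. -/
theorem sFinite_of_mem {R : Type*} [CommRing R] {S : Set R} {I : Ideal R} {s : R}
    (hs : s ∈ S) (hsI : s ∈ I) : SFinite S I :=
  ⟨s, hs, Ideal.span {s}, Submodule.fg_span_singleton s,
    fun x _ => Ideal.mul_mem_right x _ (Ideal.mem_span_singleton_self s),
    (Ideal.span_singleton_le_iff_mem I).2 hsI⟩

/-- Every ideal that is not `S`-finite lies in one that is maximal with this property. -/
theorem exists_le_maximal_not_sFinite {R : Type*} [CommRing R] {S : Set R} {I : Ideal R}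
    (hI : ¬ SFinite S I) : ∃ P, I ≤ P ∧ Maximal (fun K : Ideal R => ¬ SFinite S K) P := by
  refine zorn_le_nonempty₀ {K : Ideal R | ¬ SFinite S K} (fun c hc hchain K hK => ?_) I hI
  refine ⟨sSup c, ?_, fun L hL => le_sSup hL⟩
  rintro ⟨s, hs, F, hF, hsF, hFc⟩
  obtain ⟨L, hL, hFL⟩ := (CompleteLattice.isCompactElement_iff_le_of_directed_sSup_le _ F).1
    ((Submodule.fg_iff_compact F).1 hF) c ⟨K, hK⟩ hchain.directedOn hFc
  exact hc hL ⟨s, hs, F, hF, fun x hx => hsF x (le_sSup hL hx), hFL⟩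

/-- A finitely generated ideal below `I ⊔ K` lies below `F ⊔ K` for some finitely generated
`F ≤ I`. -/
theorem Ideal.FG.exists_fg_le_sup {R : Type*} [CommRing R] {I K G : Ideal R} (hG : G.FG)
    (h : G ≤ I ⊔ K) : ∃ F : Ideal R, F.FG ∧ F ≤ I ∧ G ≤ F ⊔ K := by
  obtain ⟨T, rfl⟩ := hG
  have hT : ∀ x : T, ∃ y ∈ I, ∃ z ∈ K, y + z = x := fun x =>
    Submodule.mem_sup.1 (h (Submodule.subset_span x.2))
  choose y hy z hz hyz using hT
  refine ⟨Ideal.span (Set.range y), Submodule.fg_span (Set.finite_range y),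
    Ideal.span_le.2 (Set.range_subset_iff.2 hy), Submodule.span_le.2 fun x hx => ?_⟩
  exact Submodule.mem_sup.2
    ⟨_, Ideal.subset_span ⟨⟨x, hx⟩, rfl⟩, _, hz ⟨x, hx⟩, hyz ⟨x, hx⟩⟩

/-- If `I + (a)` and `(I : a)` are `S`-finite, then so is `I`. -/
theorem sFinite_of_sup_of_colon {R : Type*} [CommRing R] {S : Set R} (hS : MultClosed S)
    {I : Ideal R} {a : R} (hsup : SFinite S (I ⊔ Ideal.span {a}))
    (hcolon : SFinite S (Submodule.comap (LinearMap.mulLeft R a) I)) : SFinite S I := by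
  obtain ⟨s, hs, F, hF, hsF, hFI⟩ := hsup
  obtain ⟨t, ht, G, hG, htG, hGI⟩ := hcolon
  obtain ⟨E, hE, hEI, hFE⟩ := hF.exists_fg_le_sup hFI
  refine ⟨t * s, hS.2 t ht s hs, E ⊔ Submodule.map (LinearMap.mulLeft R a) G,
    Submodule.FG.sup hE (Submodule.FG.map _ hG),
    fun x hx => ?_, sup_le hEI (Submodule.map_le_iff_le_comap.2 hGI)⟩
  obtain ⟨y, hy, z, hz, hyz⟩ := Submodule.mem_sup.1 (hFE (hsF x (Ideal.mem_sup_left hx)))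
  obtain ⟨c, rfl⟩ := Ideal.mem_span_singleton'.1 hz
  have hc : a * c ∈ I := by
    rw [mul_comm, ← add_sub_cancel_left y (c * a), hyz]
    exact I.sub_mem (I.mul_mem_left s hx) (hEI hy)
  refine Submodule.mem_sup.2 ⟨t * y, E.mul_mem_left t hy, a * (t * c),
    Submodule.mem_map_of_mem (f := LinearMap.mulLeft R a) (htG c hc), ?_⟩
  linear_combination t * hyz

/-- An ideal maximal among those that are not `S`-finite is prime. -/
theorem isPrime_of_maximal_not_sFinite {R : Type*} [CommRing R] {S : Set R}
    (hS : MultClosed S) {P : Ideal R} (hP : Maximal (fun K : Ideal R => ¬ SFinite S K) P) :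
    P.IsPrime := by
  have sFinite_of_lt : ∀ {K : Ideal R}, P < K → SFinite S K := fun hK =>
    not_not.1 (hP.not_prop_of_gt hK)
  refine ⟨?_, fun {a b} hab => ?_⟩
  · rintro rfl
    exact hP.prop (sFinite_of_mem hS.1 Submodule.mem_top)
  · by_contra! ⟨ha, hb⟩
    refine hP.prop (sFinite_of_sup_of_colon (a := a) hS (sFinite_of_lt ?_) (sFinite_of_lt ?_))
    · exact left_lt_sup.2 fun h => ha (h (Ideal.mem_span_singleton_self a))
    · exact SetLike.lt_iff_le_and_exists.2 ⟨fun x hx => P.mul_mem_left a hx, b, hab, hb⟩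

/-- Cohen-type theorem: `R` is `S`-`J`-Noetherian iff every prime `J`-ideal of `R`
disjoint from `S` is `S`-finite. -/
theorem sJNoetherian_iff_prime {R : Type*} [CommRing R] (S : Set R) (hS : MultClosed S)
    (J : Ideal R) :
    SJNoetherian S J ↔
      ∀ P : Ideal R, P.IsPrime → ¬ P ≤ J → (P : Set R) ∩ S = ∅ → SFinite S P := by
  refine ⟨fun h P _ hPJ _ => h P hPJ, fun h I hIJ => ?_⟩
  by_contra hI
  obtain ⟨P, hIP, hP⟩ := exists_le_maximal_not_sFinite hI
  have hPJ : ¬ P ≤ J := fun hPJ => hIJ (hIP.trans hPJ)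
  refine hP.prop (h P (isPrime_of_maximal_not_sFinite hS hP) hPJ ?_)
  refine Set.eq_empty_of_forall_notMem fun s hs => hP.prop ?_
  exact sFinite_of_mem hs.2 hs.1
end

section
/- Let R be a commutative ring with identity, S ⊆ R a multiplicatively closed subset, and J a proper ideal of R. Then R is S-J-Noetherian if and only if every nonempty family of J-ideals of R has an S-maximal element with respect to inclusion. -/
/-- The `S`-saturation of an ideal `I`: the elements `x` with `s * x ∈ I` for some `s ∈ S`. -/
def MultClosed.saturation {R : Type*} [CommRing R] {S : Set R} (hS : MultClosed S)
    (I : Ideal R) : Ideal R where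
  carrier := {x | ∃ s ∈ S, s * x ∈ I}
  zero_mem' := ⟨1, hS.1, by simp⟩
  add_mem' := by
    rintro a b ⟨s, hs, ha⟩ ⟨t, ht, hb⟩
    refine ⟨s * t, hS.2 s hs t ht, ?_⟩
    have h : s * t * (a + b) = t * (s * a) + s * (t * b) := by ring
    rw [h]
    exact I.add_mem (I.mul_mem_left t ha) (I.mul_mem_left s hb)
  smul_mem' := by
    rintro c x ⟨s, hs, hx⟩
    refine ⟨s, hs, ?_⟩
    rw [smul_eq_mul, mul_left_comm]
    exact I.mul_mem_left c hx

namespace MultClosed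

variable {R : Type*} [CommRing R] {S : Set R} (hS : MultClosed S)

theorem le_saturation (I : Ideal R) : I ≤ hS.saturation I :=
  fun x hx => ⟨1, hS.1, by simpa using hx⟩

theorem saturation_mono {I L : Ideal R} (h : I ≤ L) : hS.saturation I ≤ hS.saturation L :=
  fun _ ⟨s, hs, hx⟩ => ⟨s, hs, h hx⟩

theorem saturation_saturation_le (I : Ideal R) :
    hS.saturation (hS.saturation I) ≤ hS.saturation I := by
  rintro x ⟨s, hs, t, ht, hx⟩
  exact ⟨t * s, hS.2 t ht s hs, by rwa [mul_assoc]⟩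

/-- A single element of `S` carries a finitely generated subideal of the saturation into `I`. -/
theorem exists_mul_mem_of_fg_le_saturation {I F : Ideal R} (hF : F.FG)
    (h : F ≤ hS.saturation I) : ∃ t ∈ S, ∀ x ∈ F, t * x ∈ I := by
  induction F, hF using Submodule.fg_induction with
  | singleton a =>
    obtain ⟨t, ht, ha⟩ := h (Submodule.mem_span_singleton_self a)
    refine ⟨t, ht, fun x hx => ?_⟩
    obtain ⟨c, rfl⟩ := Submodule.mem_span_singleton.1 hx
    rw [smul_eq_mul, mul_left_comm]
    exact I.mul_mem_left c ha
  | sup F G _ _ ihF ihG =>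
    obtain ⟨t, ht, hF⟩ := ihF (le_sup_left.trans h)
    obtain ⟨u, hu, hG⟩ := ihG (le_sup_right.trans h)
    refine ⟨t * u, hS.2 t ht u hu, fun x hx => ?_⟩
    obtain ⟨a, ha, b, hb, rfl⟩ := Submodule.mem_sup.1 hx
    have h : t * u * (a + b) = u * (t * a) + t * (u * b) := by ring
    rw [h]
    exact I.add_mem (I.mul_mem_left u (hF a ha)) (I.mul_mem_left t (hG b hb))

/-- If the saturation of `I` is `S`-finite, then a single element of `S` carries it into `I`. -/
theorem exists_mul_mem_of_sFinite_saturation {I : Ideal R} (h : SFinite S (hS.saturation I)) :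
    ∃ s ∈ S, ∀ x ∈ hS.saturation I, s * x ∈ I := by
  obtain ⟨s, hs, F, hF, hsF, hFI⟩ := h
  obtain ⟨t, ht, htF⟩ := hS.exists_mul_mem_of_fg_le_saturation hF hFI
  exact ⟨t * s, hS.2 t ht s hs, fun x hx => by
    rw [mul_assoc]; exact htF _ (hsF x hx)⟩

/-- A chain of saturations with `S`-finite supremum attains its supremum. -/
theorem exists_mem_sSup_le_of_isChain {c : Set (Ideal R)} (hc : IsChain (· ≤ ·) c)
    (hne : c.Nonempty) (hsat : ∀ K ∈ c, hS.saturation K ≤ K) (h : SFinite S (sSup c)) :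
    ∃ K ∈ c, sSup c ≤ K := by
  obtain ⟨s, hs, F, hF, hsF, hFc⟩ := h
  obtain ⟨K, hK, hFK⟩ := (CompleteLattice.isCompactElement_iff_le_of_directed_sSup_le _ F).1
    ((Submodule.fg_iff_compact F).1 hF) c hne hc.directedOn hFc
  exact ⟨K, hK, fun x hx => hsat K hK ⟨s, hs, hFK (hsF x hx)⟩⟩

end MultClosed

/-- `R` is `S`-`J`-Noetherian iff every nonempty family of `J`-ideals has an
`S`-maximal element with respect to inclusion: an `I ∈ E` for which there is `s ∈ S`
such that `s • L ⊆ I` for every `L ∈ E` containing `I`. -/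
theorem sJNoetherian_iff_sMaximal {R : Type*} [CommRing R] (S : Set R)
    (hS : MultClosed S) (J : Ideal R) (hJ : J ≠ ⊤) :
    SJNoetherian S J ↔
      ∀ E : Set (Ideal R), E.Nonempty → (∀ I ∈ E, ¬ I ≤ J) →
        ∃ I ∈ E, ∃ s ∈ S, ∀ L ∈ E, I ≤ L → ∀ x ∈ L, s * x ∈ I := by
  constructor
  · rintro h E ⟨I₀, hI₀⟩ hE
    obtain ⟨M, -, hM⟩ := zorn_le_nonempty₀ (Set.image hS.saturation E) (by
      intro c hcE hc K₀ hK₀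
      have hsat : ∀ K ∈ c, hS.saturation K ≤ K := by
        intro K hK
        obtain ⟨I, -, rfl⟩ := hcE hK
        exact hS.saturation_saturation_le I
      have hcJ : ¬ sSup c ≤ J := by
        intro hle
        obtain ⟨I, hI, rfl⟩ := hcE hK₀
        exact hE I hI ((hS.le_saturation I).trans ((le_sSup hK₀).trans hle))
      obtain ⟨K, hK, hle⟩ := hS.exists_mem_sSup_le_of_isChain hc ⟨K₀, hK₀⟩ hsat (h _ hcJ)
      exact ⟨K, hcE hK, fun L hL => (le_sSup hL).trans hle⟩) _ ⟨I₀, hI₀, rfl⟩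
    obtain ⟨I, hI, rfl⟩ := hM.1
    obtain ⟨s, hs, hsI⟩ := hS.exists_mul_mem_of_sFinite_saturation
      (h _ fun hle => hE I hI ((hS.le_saturation I).trans hle))
    exact ⟨I, hI, s, hs, fun L hL hIL x hx =>
      hsI x (hM.2 ⟨L, hL, rfl⟩ (hS.saturation_mono hIL) (hS.le_saturation L hx))⟩
  · intro h I hI
    obtain ⟨a, haI, haJ⟩ := SetLike.not_le_iff_exists.1 hI
    obtain ⟨F, ⟨hF, hFI, hFJ⟩, s, hs, hmax⟩ := h {F | F.FG ∧ F ≤ I ∧ ¬ F ≤ J}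
      ⟨Ideal.span {a}, Submodule.fg_span_singleton a, by simpa [Ideal.span_le] using haI,
        by simpa [Ideal.span_le] using haJ⟩ (fun F hF => hF.2.2)
    refine ⟨s, hs, F, hF, fun x hx => ?_, hFI⟩
    exact hmax (F ⊔ Ideal.span {x})
      ⟨Submodule.FG.sup hF (Submodule.fg_span_singleton x),
        sup_le hFI (by simpa [Ideal.span_le] using hx), fun hle => hFJ (le_sup_left.trans hle)⟩
      le_sup_left x (Ideal.mem_sup_right (Ideal.mem_span_singleton_self x))
end

section
/- Let f : R → R' be a surjective homomorphism of commutative rings, S ⊆ R a multiplicatively closed subset with 0 ∉ f(S), and J an ideal of R'. If R is S-f⁻¹(J)-Noetherian, then R' is f(S)-J-Noetherian. -/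
/-- If `f : R → R'` is a surjective ring homomorphism, `0 ∉ f(S)`, and `R` is
`S`-`f⁻¹(J)`-Noetherian, then `R'` is `f(S)`-`J`-Noetherian. -/
theorem sJNoetherian_of_surjective {R R' : Type*} [CommRing R] [CommRing R']
    (f : R →+* R') (hf : Function.Surjective f) (S : Set R) (hS : MultClosed S)
    (h0 : (0 : R') ∉ f '' S) (J : Ideal R')
    (hR : SJNoetherian S (J.comap f)) :
    SJNoetherian (f '' S) J := by
  intro I hI
  have hI' : ¬ I.comap f ≤ J.comap f :=
    fun h => hI ((Ideal.comap_le_comap_iff_of_surjective f hf I J).mp h)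
  obtain ⟨s, hs, F, hF, hsF, hFI⟩ := hR (I.comap f) hI'
  refine ⟨f s, ⟨s, hs, rfl⟩, F.map f, hF.map f, fun y hy => ?_, Ideal.map_le_iff_le_comap.mpr hFI⟩
  obtain ⟨x, rfl⟩ := hf y
  rw [← map_mul]
  exact Ideal.mem_map_of_mem f (hsF x hy)
end

section
/- Let R be a commutative ring with identity, S ⊆ R a multiplicatively closed subset, and J an ideal of R. If R is S-J-Noetherian, then the quotient ring R/J is S̄-Noetherian, where S̄ = {s + J : s ∈ S} is the image of S in R/J. -/
/-- If `R` is `S`-`J`-Noetherian then `R/J` is `S̄`-Noetherian, where `S̄` is the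
image of `S` in `R/J`. -/
theorem quotient_sNoetherian {R : Type*} [CommRing R] (S : Set R) (hS : MultClosed S)
    (J : Ideal R) (hSJ : SJNoetherian S J) :
    SNoetherian ((Ideal.Quotient.mk J) '' S : Set (R ⧸ J)) := by
  intro I
  by_cases hI : I.comap (Ideal.Quotient.mk J) ≤ J
  · refine ⟨1, ⟨1, hS.1, map_one _⟩, ⊥, Submodule.fg_bot, fun x hx => ?_, bot_le⟩
    obtain ⟨r, rfl⟩ := Ideal.Quotient.mk_surjective x
    rw [one_mul, Ideal.mem_bot, Ideal.Quotient.eq_zero_iff_mem]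
    exact hI hx
  · obtain ⟨s, hs, F, hF, hsF, hFI⟩ := hSJ _ hI
    refine ⟨_, ⟨s, hs, rfl⟩, F.map (Ideal.Quotient.mk J), hF.map _, fun x hx => ?_,
      Ideal.map_le_iff_le_comap.mpr hFI⟩
    obtain ⟨r, rfl⟩ := Ideal.Quotient.mk_surjective x
    rw [← map_mul]
    exact Ideal.mem_map_of_mem _ (hsF r hx)
end

section
/- Let R be a commutative ring with identity, S ⊆ R an anti-Archimedean multiplicatively closed subset, and J an ideal of R. If R is S-J-Noetherian, then for every n ≥ 1 the polynomial ring (R/J)[X₁,…,Xₙ] is S̄-Noetherian, where S̄ = {s + J : s ∈ S} is viewed inside (R/J)[X₁,…,Xₙ] via the constant polynomials. -/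
/-- `S` is anti-Archimedean if for each `s ∈ S` the intersection `⋂_{n ≥ 1} sⁿR`
meets `S`. -/
def AntiArchimedean {R : Type*} [CommRing R] (S : Set R) : Prop :=
  ∀ s ∈ S, ∃ t ∈ S, ∀ n : ℕ, 1 ≤ n → s ^ n ∣ t

open Polynomial in
theorem Ideal.mem_leadingCoeffNth_iff_coeff {A : Type*} [CommRing A] {I : Ideal A[X]} {d : ℕ}
    {a : A} : a ∈ I.leadingCoeffNth d ↔ ∃ p ∈ I, p.degree ≤ d ∧ p.coeff d = a := by
  simp only [Ideal.leadingCoeffNth, Ideal.degreeLE, Submodule.mem_map, Submodule.mem_inf,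
    mem_degreeLE, lcoeff_apply]
  exact ⟨fun ⟨p, ⟨h1, h2⟩, h3⟩ => ⟨p, h2, h1, h3⟩, fun ⟨p, h2, h1, h3⟩ => ⟨p, ⟨h1, h2⟩, h3⟩⟩

open Polynomial in
/-- Lifting a finitely generated ideal of leading coefficients to a finitely generated ideal. -/
theorem Ideal.FG.exists_le_leadingCoeffNth {A : Type*} [CommRing A] {I : Ideal A[X]} {d : ℕ}
    {G : Ideal A} (hG : G.FG) (hGI : G ≤ I.leadingCoeffNth d) :
    ∃ F : Ideal A[X], F.FG ∧ F ≤ I ∧ G ≤ F.leadingCoeffNth d := by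
  classical
  obtain ⟨T, rfl⟩ := hG
  have key : ∀ a : T, ∃ p ∈ I, p.degree ≤ d ∧ p.coeff d = a := fun a =>
    Ideal.mem_leadingCoeffNth_iff_coeff.1 (hGI (Ideal.subset_span a.2))
  choose p hpI hpd hpc using key
  refine ⟨Ideal.span (Finset.univ.image p : Finset A[X]), ⟨_, rfl⟩, ?_, ?_⟩
  · refine Ideal.span_le.2 fun f hf => ?_
    obtain ⟨a, -, rfl⟩ := Finset.mem_image.1 (Finset.mem_coe.1 hf)
    exact hpI a
  · refine Ideal.span_le.2 fun a ha => ?_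
    rw [SetLike.mem_coe, Ideal.mem_leadingCoeffNth_iff_coeff]
    refine ⟨p ⟨a, ha⟩, Ideal.subset_span ?_, hpd _, hpc _⟩
    simp

open Polynomial in
/-- If `s` carries the `j`-th leading coefficients of `I` into those of `F`, then `s f` can be
reduced modulo `F` to an element of smaller degree. -/
theorem Ideal.exists_mem_degree_C_mul_sub_lt {A : Type*} [CommRing A] {I F : Ideal A[X]} {s : A}
    {j : ℕ} (h : ∀ a ∈ I.leadingCoeffNth j, s * a ∈ F.leadingCoeffNth j) {f : A[X]} (hf : f ∈ I)
    (hfd : f.degree < (j + 1 : ℕ)) : ∃ g ∈ F, (C s * f - g).degree < j := by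
  have hfd' : ∀ i, j < i → f.coeff i = 0 := fun i hi =>
    (degree_lt_iff_coeff_zero f (j + 1)).1 hfd i hi
  obtain ⟨g, hg, hgd, hgc⟩ := Ideal.mem_leadingCoeffNth_iff_coeff.1 (h (f.coeff j)
    (Ideal.mem_leadingCoeffNth_iff_coeff.2 ⟨f, hf, (degree_le_iff_coeff_zero f j).2
      fun i hi => hfd' i (by exact_mod_cast hi), rfl⟩))
  refine ⟨g, hg, (degree_lt_iff_coeff_zero _ _).2 fun i hi => ?_⟩
  rcases hi.eq_or_lt with rfl | hi
  · simp [hgc]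
  · have : g.coeff i = 0 := (degree_le_iff_coeff_zero g j).1 hgd i (by exact_mod_cast hi)
    simp [this, hfd' i hi]

theorem MultClosed.image {A B : Type*} [CommRing A] [CommRing B] (φ : A →+* B) {S : Set A}
    (hS : MultClosed S) : MultClosed (φ '' S) := by
  refine ⟨⟨1, hS.1, map_one φ⟩, ?_⟩
  rintro _ ⟨a, ha, rfl⟩ _ ⟨b, hb, rfl⟩
  exact ⟨a * b, hS.2 a ha b hb, map_mul φ a b⟩

theorem AntiArchimedean.image {A B : Type*} [CommRing A] [CommRing B] (φ : A →+* B) {S : Set A}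
    (hS : AntiArchimedean S) : AntiArchimedean (φ '' S) := by
  rintro _ ⟨s, hs, rfl⟩
  obtain ⟨t, ht, h⟩ := hS s hs
  exact ⟨φ t, ⟨t, ht, rfl⟩, fun n hn => map_pow φ s n ▸ map_dvd φ (h n hn)⟩

theorem SFinite.map {A B : Type*} [CommRing A] [CommRing B] {φ : A →+* B}
    (hφ : Function.Surjective φ) {S : Set A} {I : Ideal B} (h : SFinite S (I.comap φ)) :
    SFinite (φ '' S) I := by
  obtain ⟨s, hs, F, hF, hsF, hFI⟩ := h
  refine ⟨φ s, ⟨s, hs, rfl⟩, F.map φ, hF.map φ, fun x hx => ?_, Ideal.map_le_iff_le_comap.2 hFI⟩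
  obtain ⟨y, rfl⟩ := hφ x
  rw [← map_mul]
  exact Ideal.mem_map_of_mem φ (hsF y hx)

theorem SNoetherian.image {A B : Type*} [CommRing A] [CommRing B] {φ : A →+* B}
    (hφ : Function.Surjective φ) {S : Set A} (h : SNoetherian S) : SNoetherian (φ '' S) :=
  fun I => (h (I.comap φ)).map hφ

theorem SJNoetherian.quotient {R : Type*} [CommRing R] {S : Set R} {J : Ideal R}
    (hS : MultClosed S) (h : SJNoetherian S J) : SNoetherian (Ideal.Quotient.mk J '' S) := by
  intro I
  by_cases hI : I.comap (Ideal.Quotient.mk J) ≤ J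
  · have hI0 : I = ⊥ := by
      refine (Submodule.eq_bot_iff I).2 fun x hx => ?_
      obtain ⟨y, rfl⟩ := Ideal.Quotient.mk_surjective x
      exact Ideal.Quotient.eq_zero_iff_mem.2 (hI hx)
    subst hI0
    exact ⟨1, (hS.image _).1, ⊥, Submodule.fg_bot, by simp, le_rfl⟩
  · exact (h _ hI).map Ideal.Quotient.mk_surjective

open Polynomial in
/-- Hilbert basis theorem for `S`-Noetherian rings with `S` anti-Archimedean. -/
theorem SNoetherian.polynomial {A : Type*} [CommRing A] {S : Set A} (hS : MultClosed S)
    (hAA : AntiArchimedean S) (h : SNoetherian S) : SNoetherian ((C : A →+* A[X]) '' S) := by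
  intro I
  have low : ∀ j : ℕ, ∃ s ∈ S, ∃ F : Ideal A[X], F.FG ∧ F ≤ I ∧
      ∀ f ∈ I, f.degree < j → C s * f ∈ F := by
    intro j
    induction j with
    | zero =>
      refine ⟨1, hS.1, ⊥, Submodule.fg_bot, bot_le, fun f _ hfd => ?_⟩
      have : f = 0 := by
        ext i
        exact (degree_lt_iff_coeff_zero f 0).1 hfd i i.zero_le
      simp [this]
    | succ j ih =>
      obtain ⟨s, hs, F, hF, hFI, hsF⟩ := ih
      obtain ⟨r, hr, G, hG, hrG, hGL⟩ := h (I.leadingCoeffNth j)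
      obtain ⟨F', hF', hFI', hGF'⟩ := hG.exists_le_leadingCoeffNth hGL
      refine ⟨s * r, hS.2 s hs r hr, F ⊔ F', Submodule.FG.sup hF hF', sup_le hFI hFI', fun f hf hfd => ?_⟩
      obtain ⟨g, hg, hgd⟩ := Ideal.exists_mem_degree_C_mul_sub_lt
        (fun a ha => hGF' (hrG a ha)) hf hfd
      have h1 := hsF _ (I.sub_mem (I.mul_mem_left _ hf) (hFI' hg)) hgd
      have h2 : C (s * r) * f = C s * (C r * f - g) + C s * g := by rw [C_mul]; ring
      rw [h2]
      exact Submodule.add_mem_sup h1 (F'.mul_mem_left _ hg)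
  obtain ⟨s, hs, G, hG, hsG, hGL⟩ := h I.leadingCoeff
  obtain ⟨d, hd⟩ : ∃ d, G ≤ I.leadingCoeffNth d := by
    obtain ⟨T, rfl⟩ := hG
    have hdir : Directed (· ≤ ·) I.leadingCoeffNth :=
      Monotone.directed_le fun _ _ => I.leadingCoeffNth_mono
    obtain ⟨d, hd⟩ := hdir.exists_mem_subset_of_finset_subset_biUnion (s := T)
      (f := fun i => (I.leadingCoeffNth i : Set A)) fun a ha => by
        simpa using (Submodule.mem_iSup_of_directed _ hdir).1 (hGL (Ideal.subset_span ha))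
    exact ⟨d, Ideal.span_le.2 hd⟩
  obtain ⟨F₁, hF₁, hFI₁, hGF₁⟩ := hG.exists_le_leadingCoeffNth hd
  obtain ⟨r, hr, F₀, hF₀, hFI₀, hrF₀⟩ := low d
  have high : ∀ k : ℕ, ∀ f ∈ I, f.degree < (d + k : ℕ) → C (r * s ^ k) * f ∈ F₀ ⊔ F₁ := by
    intro k
    induction k with
    | zero =>
      intro f hf hfd
      simpa using Ideal.mem_sup_left (hrF₀ f hf hfd)
    | succ k ih =>
      intro f hf hfd
      obtain ⟨g, hg, hgd⟩ := Ideal.exists_mem_degree_C_mul_sub_lt (F := F₁) (s := s) (j := d + k)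
        (fun a ha => F₁.leadingCoeffNth_mono (Nat.le_add_right d k)
          (hGF₁ (hsG a (Submodule.mem_iSup_of_mem _ ha)))) hf hfd
      have h1 := ih _ (I.sub_mem (I.mul_mem_left _ hf) (hFI₁ hg)) hgd
      have h2 : C (r * s ^ (k + 1)) * f =
          C (r * s ^ k) * (C s * f - g) + C (r * s ^ k) * g := by
        simp only [C_mul, pow_succ]; ring
      rw [h2]
      exact add_mem h1 (Ideal.mem_sup_right (F₁.mul_mem_left _ hg))
  obtain ⟨t, ht, hst⟩ := hAA s hs
  refine ⟨C (r * t), ⟨r * t, hS.2 r hr t ht, rfl⟩, F₀ ⊔ F₁, Submodule.FG.sup hF₀ hF₁, fun f hf => ?_,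
    sup_le hFI₀ hFI₁⟩
  obtain ⟨u, rfl⟩ := hst (f.natDegree + 1) (Nat.le_add_left 1 _)
  have h1 := high (f.natDegree + 1) f hf
    (degree_le_natDegree.trans_lt (by exact_mod_cast (by omega)))
  have h2 : C (r * (s ^ (f.natDegree + 1) * u)) * f =
      C u * (C (r * s ^ (f.natDegree + 1)) * f) := by
    simp only [C_mul]; ring
  rw [h2]
  exact Ideal.mul_mem_left _ _ h1

theorem SNoetherian.mvPolynomial {A : Type*} [CommRing A] {S : Set A} (hS : MultClosed S)
    (hAA : AntiArchimedean S) (h : SNoetherian S) (n : ℕ) :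
    SNoetherian ((MvPolynomial.C : A →+* MvPolynomial (Fin n) A) '' S) := by
  induction n with
  | zero => exact h.image (MvPolynomial.C_surjective (Fin 0))
  | succ n ih =>
    let e := (MvPolynomial.finSuccEquiv A n).symm.toRingEquiv
    have h1 := (ih.polynomial (hS.image _) (hAA.image _)).image
      (φ := e.toRingHom) e.surjective
    rw [Set.image_image, Set.image_image] at h1
    convert h1 using 3 with a
    exact (RingHom.congr_fun (MvPolynomial.finSuccEquiv_comp_C_eq_C n) a).symm

/-- If `S` is anti-Archimedean and `R` is `S`-`J`-Noetherian, then `(R/J)[X₁,…,Xₙ]`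
is `S̄`-Noetherian, where `S̄` is the image of `S` in `R/J` viewed via constant
polynomials. -/
theorem quotient_polynomialRing_sNoetherian {R : Type*} [CommRing R] (S : Set R)
    (hS : MultClosed S) (hAA : AntiArchimedean S) (J : Ideal R)
    (hSJ : SJNoetherian S J) (n : ℕ) (hn : 1 ≤ n) :
    SNoetherian
      ((MvPolynomial.C '' ((Ideal.Quotient.mk J) '' S) :
        Set (MvPolynomial (Fin n) (R ⧸ J)))) := by
  exact (hSJ.quotient hS).mvPolynomial (hS.image _) (hAA.image _) n
end

section
/- Let R be a commutative ring with identity, S ⊆ R a multiplicatively closed subset, and J an ideal of R. Suppose R is S-J-Noetherian, J is a divided ideal of R, and I is a proper J-ideal of R with I ∩ S = ∅. Then there exist s ∈ S, an integer n ≥ 1, and S-prime ideals P₁, …, Pₙ of R such that s·(P₁⋯Pₙ) ⊆ I. -/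
/-- A proper ideal `P` disjoint from `S` is `S`-prime if there is `s ∈ S` such that
`ab ∈ P` implies `sa ∈ P` or `sb ∈ P`. -/
def SPrime {R : Type*} [CommRing R] (S : Set R) (P : Ideal R) : Prop :=
  P ≠ ⊤ ∧ (P : Set R) ∩ S = ∅ ∧
    ∃ s ∈ S, ∀ a b : R, a * b ∈ P → s * a ∈ P ∨ s * b ∈ P

/-- Some multiple by an element of `S` of a nonempty finite product of `S`-prime ideals lies
in `I`. -/
def ContainsSPrimeProduct {R : Type*} [CommRing R] (S : Set R) (I : Ideal R) : Prop :=
  ∃ s ∈ S, ∃ n : ℕ, 1 ≤ n ∧ ∃ P : Fin n → Ideal R,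
    (∀ i, SPrime S (P i)) ∧ ∀ x ∈ (∏ i, P i : Ideal R), s * x ∈ I

namespace ContainsSPrimeProduct

variable {R : Type*} [CommRing R] {S : Set R} {I K L : Ideal R}

theorem of_sPrime (hS : MultClosed S) (h : SPrime S I) : ContainsSPrimeProduct S I :=
  ⟨1, hS.1, 1, le_rfl, fun _ => I, fun _ => h, fun x hx => by simpa using hx⟩

theorem of_smul_le (hS : MultClosed S) {t : R} (ht : t ∈ S) (h : ∀ x ∈ K, t * x ∈ I)
    (hK : ContainsSPrimeProduct S K) : ContainsSPrimeProduct S I := by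
  obtain ⟨s, hs, n, hn, P, hP, hsP⟩ := hK
  exact ⟨t * s, hS.2 t ht s hs, n, hn, P, hP, fun x hx => by
    simpa [mul_assoc] using h _ (hsP x hx)⟩

theorem of_mul_le (hS : MultClosed S) (hK : ContainsSPrimeProduct S K)
    (hL : ContainsSPrimeProduct S L) (h : K * L ≤ I) : ContainsSPrimeProduct S I := by
  obtain ⟨s, hs, m, hm, P, hP, hsP⟩ := hK
  obtain ⟨t, ht, n, -, Q, hQ, htQ⟩ := hL
  refine ⟨s * t, hS.2 s hs t ht, m + n, by omega, Fin.append P Q,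
    fun i => Fin.addCases (by simpa using hP) (by simpa using hQ) i, fun x hx => ?_⟩
  rw [Fin.prod_univ_add] at hx
  simp only [Fin.append_left, Fin.append_right] at hx
  induction hx using Submodule.mul_induction_on' with
  | mem_mul_mem p hp q hq =>
    have := h (Ideal.mul_mem_mul (hsP p hp) (htQ q hq))
    rwa [mul_mul_mul_comm] at this
  | add x _ y _ hx hy =>
    rw [mul_add]
    exact I.add_mem hx hy

/-- If every strictly larger ideal disjoint from `S` contains an `S`-multiple of a product of
`S`-prime ideals, then so does `I`: otherwise `I` would itself be prime. -/
theorem of_forall_gt (hS : MultClosed S) (hI : ∀ x ∈ I, x ∉ S)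
    (hmax : ∀ K : Ideal R, I < K → (∀ x ∈ K, x ∉ S) → ContainsSPrimeProduct S K) :
    ContainsSPrimeProduct S I := by
  by_contra hbad
  have hsat : ∀ t ∈ S, ∀ x, t * x ∈ I → x ∈ I := by
    intro t ht x hx
    by_contra hxI
    let K : Ideal R := Submodule.comap (LinearMap.mulLeft R t) I
    have hK : ∀ y ∈ K, t * y ∈ I := fun y hy => hy
    refine hbad (of_smul_le hS ht hK (hmax K ?_ fun y hy hyS => hI _ (hK y hy) (hS.2 t ht y hyS)))
    exact lt_of_le_of_ne (fun y hy => I.mul_mem_left t hy) fun h => hxI (h ▸ hx)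
  refine hbad (of_sPrime hS ⟨fun h => hI 1 (h ▸ trivial) hS.1,
    Set.eq_empty_iff_forall_notMem.2 fun x hx => hI x hx.1 hx.2, 1, hS.1, fun a b hab => ?_⟩)
  simp only [one_mul]
  by_contra! hne
  have key : ∀ a b : R, a * b ∈ I → a ∉ I → b ∉ I →
      ContainsSPrimeProduct S (I ⊔ Ideal.span {a}) := by
    intro a b hab ha hb
    refine hmax _ (left_lt_sup.2 fun h => ha (h (Ideal.mem_span_singleton_self a)))
      fun x hx hxS => hb (hsat x hxS b ?_)
    obtain ⟨y, hy, z, hz, rfl⟩ := Submodule.mem_sup.1 hx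
    obtain ⟨r, rfl⟩ := Ideal.mem_span_singleton'.1 hz
    rw [add_mul, mul_assoc]
    exact I.add_mem (I.mul_mem_right b hy) (I.mul_mem_left r hab)
  refine hbad (of_mul_le hS (key a b hab hne.1 hne.2) (key b a (mul_comm a b ▸ hab) hne.2 hne.1) ?_)
  rw [Ideal.sup_mul, Ideal.mul_sup]
  refine sup_le (sup_le Ideal.mul_le_left Ideal.mul_le_left) ?_
  rw [Ideal.mul_sup, Ideal.span_singleton_mul_span_singleton]
  exact sup_le Ideal.mul_le_right ((Ideal.span_singleton_le_iff_mem I).2 hab)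

/-- If every ideal containing `I` is `S`-finite and `I` is disjoint from `S`, then `I` contains
an `S`-multiple of a product of `S`-prime ideals. -/
theorem of_forall_sFinite (hS : MultClosed S) (hI : ∀ x ∈ I, x ∉ S)
    (hfin : ∀ K : Ideal R, I ≤ K → SFinite S K) : ContainsSPrimeProduct S I := by
  by_contra hbad
  obtain ⟨M, hIM, hM⟩ := zorn_le_nonempty₀
    {K : Ideal R | I ≤ K ∧ (∀ x ∈ K, x ∉ S) ∧ ¬ ContainsSPrimeProduct S K}
    (fun c hc hchain y hy => by
      refine ⟨sSup c, ⟨(hc hy).1.trans (le_sSup hy), fun x hx => ?_, fun hgood => ?_⟩,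
        fun z hz => le_sSup hz⟩
      · obtain ⟨K, hK, hxK⟩ := (Submodule.mem_sSup_of_directed ⟨y, hy⟩ hchain.directedOn).1 hx
        exact (hc hK).2.1 x hxK
      · obtain ⟨s, hs, F, hF, hsF, hFle⟩ := hfin (sSup c) ((hc hy).1.trans (le_sSup hy))
        obtain ⟨K, hK, hFK⟩ := (CompleteLattice.isCompactElement_iff_le_of_directed_sSup_le _ F).1
          ((Submodule.fg_iff_compact F).1 hF) c ⟨y, hy⟩ hchain.directedOn hFle
        exact (hc hK).2.2 (of_smul_le hS hs (fun x hx => hFK (hsF x hx)) hgood))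
    I ⟨le_rfl, hI, hbad⟩
  refine hM.prop.2.2 (of_forall_gt hS hM.prop.2.1 fun K hMK hK => ?_)
  by_contra hKbad
  exact hM.not_prop_of_gt hMK ⟨hIM.trans hMK.le, hK, hKbad⟩

end ContainsSPrimeProduct

/-- If `R` is `S`-`J`-Noetherian, `J` is a divided ideal, and `I` is a proper `J`-ideal
disjoint from `S`, then there exist `s ∈ S` and `S`-prime ideals `P₁, …, Pₙ` with
`s(P₁ ⋯ Pₙ) ⊆ I`. -/
theorem exists_sPrime_product {R : Type*} [CommRing R] (S : Set R) (hS : MultClosed S)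
    (J : Ideal R) (hdiv : ∀ x : R, x ∉ J → J < Ideal.span {x})
    (hSJ : SJNoetherian S J) (I : Ideal R) (hItop : I ≠ ⊤) (hIJ : ¬ I ≤ J)
    (hIS : (I : Set R) ∩ S = ∅) :
    ∃ s ∈ S, ∃ n : ℕ, 1 ≤ n ∧ ∃ P : Fin n → Ideal R,
      (∀ i, SPrime S (P i)) ∧ ∀ x ∈ (∏ i, P i : Ideal R), s * x ∈ I := by
  exact ContainsSPrimeProduct.of_forall_sFinite hS
    (fun x hx hxS => Set.eq_empty_iff_forall_notMem.1 hIS x ⟨hx, hxS⟩)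
    fun K hIK => hSJ K fun hKJ => hIJ (hIK.trans hKJ)
end

section
/- Let R ⊆ R' be an extension of commutative rings such that IR' ∩ R = I for every ideal I of R, let S ⊆ R be a multiplicatively closed subset, and let J be an ideal of R'. If R' is S-J-Noetherian, then R is S-(J ∩ R)-Noetherian. -/
/-- A finitely generated ideal contained in the extension `I.map f` is contained in the extension
of a finitely generated ideal contained in `I`. -/
theorem Ideal.FG.exists_fg_le_map {A B : Type*} [CommRing A] [CommRing B] (f : A →+* B)
    {I : Ideal A} {F : Ideal B} (hF : F.FG) (hFI : F ≤ I.map f) :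
    ∃ G : Ideal A, G.FG ∧ G ≤ I ∧ F ≤ G.map f := by
  classical
  have hsup : I.map f ≤ ⨆ a : I, Ideal.span {f a} :=
    Ideal.map_le_iff_le_comap.2 fun a ha =>
      (le_iSup (fun a : I => Ideal.span {f a}) ⟨a, ha⟩) (Ideal.mem_span_singleton_self _)
  obtain ⟨t, ht⟩ := CompleteLattice.IsCompactElement.exists_finset_of_le_iSup _
    ((Submodule.fg_iff_compact F).1 hF) _ (hFI.trans hsup)
  refine ⟨Ideal.span (t.image (↑) : Finset A), ⟨_, rfl⟩, Ideal.span_le.2 ?_, ht.trans ?_⟩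
  · intro x hx
    obtain ⟨a, -, rfl⟩ := Finset.mem_image.1 (Finset.mem_coe.1 hx)
    exact a.2
  · refine iSup₂_le fun a ha => (Ideal.span_singleton_le_iff_mem _).2 ?_
    exact Ideal.mem_map_of_mem f
      (Ideal.subset_span (Finset.mem_coe.2 (Finset.mem_image_of_mem _ ha)))

/-- Let `R ⊆ R'` be a ring extension with `IR' ∩ R = I` for every ideal `I` of `R`.
If `R'` is `S`-`J`-Noetherian, then `R` is `S`-`(J ∩ R)`-Noetherian. -/
theorem sJNoetherian_of_extension {R' : Type*} [CommRing R'] (A : Subring R')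
    (S : Set A) (hS : MultClosed S)
    (hext : ∀ I : Ideal A, (I.map A.subtype).comap A.subtype = I)
    (J : Ideal R') (hSJ : SJNoetherian ((A.subtype : A →+* R') '' S) J) :
    SJNoetherian S (J.comap A.subtype) := by
  intro I hI
  obtain ⟨_, ⟨s, hs, rfl⟩, F, hF, hsF, hFI⟩ :=
    hSJ (I.map A.subtype) fun h => hI (Ideal.map_le_iff_le_comap.1 h)
  obtain ⟨G, hG, hGI, hFG⟩ := hF.exists_fg_le_map A.subtype hFI
  refine ⟨s, hs, G, hG, fun x hx => ?_, hGI⟩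
  rw [← hext G, Ideal.mem_comap, map_mul]
  exact hFG (hsF _ (Ideal.mem_map_of_mem _ hx))
end

section
/- Let R be a commutative ring with identity, S ⊆ R a multiplicatively closed subset, and J an ideal of R. Suppose R is S-J-Noetherian and I is a J-ideal of R with I ∩ S = ∅. Then there exist t ∈ S and m ∈ ℕ, m ≥ 1, such that t·(rad(I))^m ⊆ I, where rad(I) denotes the radical of I. -/
/-- If `R` is `S`-`J`-Noetherian and `I` is a `J`-ideal of `R` disjoint from `S`, then
there exist `t ∈ S` and `m ≥ 1` with `t · (rad I)^m ⊆ I`. -/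
theorem exists_radical_pow_le {R : Type*} [CommRing R] (S : Set R) (hS : MultClosed S)
    (J : Ideal R) (hSJ : SJNoetherian S J) (I : Ideal R) (hIJ : ¬ I ≤ J)
    (hIS : (I : Set R) ∩ S = ∅) :
    ∃ t ∈ S, ∃ m : ℕ, 1 ≤ m ∧ ∀ x ∈ I.radical ^ m, t * x ∈ I := by
  obtain ⟨s, hs, F, hF, hsF, hFI⟩ := hSJ I.radical fun h => hIJ (Ideal.le_radical.trans h)
  obtain ⟨n, hn⟩ := Ideal.exists_pow_le_of_le_radical_of_fg hFI hF
  let S' : Submonoid R :=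
    { carrier := S, one_mem' := hS.1, mul_mem' := fun ha hb => hS.2 _ ha _ hb }
  refine ⟨s ^ (n + 1), S'.pow_mem hs (n + 1), n + 1, n.succ_pos, fun x hx => ?_⟩
  have hle : Ideal.span {s} * I.radical ≤ F := Ideal.span_singleton_mul_le_iff.2 hsF
  apply (Ideal.pow_right_mono hle (n + 1)).trans ((Ideal.pow_le_pow_right n.le_succ).trans hn)
  rw [mul_pow, Ideal.span_singleton_pow]
  exact Ideal.mul_mem_mul (Ideal.mem_span_singleton_self _) hx
end

section
/- Let R be a commutative ring with identity, S ⊆ R a multiplicatively closed subset, and J an ideal of R. If R is S-J-Noetherian and I is a J-ideal of R, then the quotient ring R/I is S̄-Noetherian, where S̄ = {s + I : s ∈ S} is the image of S in R/I. -/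
/-- The image of an `S`-finite ideal under a surjective ring homomorphism is finite
with respect to the image of `S`. -/
theorem SFinite.map_of_surjective {R R' : Type*} [CommRing R] [CommRing R'] {S : Set R}
    {I : Ideal R} (h : SFinite S I) {f : R →+* R'} (hf : Function.Surjective f) :
    SFinite (f '' S) (I.map f) := by
  obtain ⟨s, hs, F, hF, hsF, hFI⟩ := h
  refine ⟨f s, ⟨s, hs, rfl⟩, F.map f, hF.map f, fun y hy => ?_, Ideal.map_mono hFI⟩
  obtain ⟨x, hx, rfl⟩ := (Ideal.mem_map_iff_of_surjective f hf).1 hy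
  rw [← map_mul]
  exact Ideal.mem_map_of_mem f (hsF x hx)

/-- If `R` is `S`-`J`-Noetherian and `I` is a `J`-ideal of `R`, then `R/I` is
`S̄`-Noetherian, where `S̄` is the image of `S` in `R/I`. -/
theorem quotient_by_JIdeal_sNoetherian {R : Type*} [CommRing R] (S : Set R)
    (hS : MultClosed S) (J : Ideal R) (hSJ : SJNoetherian S J) (I : Ideal R)
    (hIJ : ¬ I ≤ J) :
    SNoetherian ((Ideal.Quotient.mk I) '' S : Set (R ⧸ I)) := by
  intro K
  have hIK : I ≤ K.comap (Ideal.Quotient.mk I) := fun x hx => by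
    simp [Ideal.mem_comap, Ideal.Quotient.eq_zero_iff_mem.2 hx]
  have h := (hSJ _ fun hKJ => hIJ (hIK.trans hKJ)).map_of_surjective
    (Ideal.Quotient.mk_surjective (I := I))
  rwa [Ideal.map_comap_of_surjective _ Ideal.Quotient.mk_surjective] at h
end

section
/- Let R be a decomposable commutative ring (i.e., R has an idempotent e with e ≠ 0 and e ≠ 1), S ⊆ R a multiplicatively closed subset, and J an ideal of R such that eJ ≠ (e) for every idempotent e ∈ R with e ∉ {0,1}, where eJ = {ex : x ∈ J} and (e) is the principal ideal generated by e. Then R is S-J-Noetherian if and only if R is S-Noetherian. -/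
/-- If `I + (e)` is `S`-finite for an idempotent `e`, then the component `(1 - e) I` is
`S`-finite, witnessed by a finitely generated ideal contained in `I`. -/
theorem SFinite.exists_fg_le_of_sup_span_idempotent {R : Type*} [CommRing R] {S : Set R}
    {I : Ideal R} {e : R} (he : e * e = e) (h : SFinite S (I ⊔ Ideal.span {e})) :
    ∃ s ∈ S, ∃ F : Ideal R, F.FG ∧ (∀ x ∈ I, s * ((1 - e) * x) ∈ F) ∧ F ≤ I := by
  obtain ⟨s, hs, F, hF, hsF, hFI⟩ := h
  refine ⟨s, hs, Ideal.span {1 - e} * F, Submodule.FG.mul ⟨{1 - e}, by simp⟩ hF, ?_, ?_⟩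
  · intro x hx
    rw [mul_left_comm]
    exact Ideal.mul_mem_mul (Ideal.mem_span_singleton_self _) (hsF x (Ideal.mem_sup_left hx))
  · refine Ideal.span_singleton_mul_le_iff.2 fun z hz => ?_
    obtain ⟨y, hy, w, hw, rfl⟩ := Submodule.mem_sup.1 (hFI hz)
    obtain ⟨r, rfl⟩ := Ideal.mem_span_singleton'.1 hw
    have hyr : (1 - e) * (y + r * e) = (1 - e) * y := by
      linear_combination (-r) * he
    rw [hyr]
    exact I.mul_mem_left _ hy

/-- An idempotent `e` lying in `J` satisfies `eJ = (e)`. -/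
theorem image_mul_eq_span_of_idempotent_mem {R : Type*} [CommRing R] {J : Ideal R} {e : R}
    (he : e * e = e) (heJ : e ∈ J) :
    (fun x => e * x) '' (J : Set R) = ((Ideal.span {e} : Ideal R) : Set R) := by
  ext y
  simp only [Set.mem_image, SetLike.mem_coe, Ideal.mem_span_singleton']
  constructor
  · rintro ⟨x, -, rfl⟩
    exact ⟨x, mul_comm x e⟩
  · rintro ⟨r, rfl⟩
    exact ⟨r * e, J.mul_mem_left r heJ, by linear_combination r * he⟩

/-- If `R` is decomposable and `eJ ≠ (e)` for every nontrivial idempotent `e`, then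
`R` is `S`-`J`-Noetherian iff `R` is `S`-Noetherian. -/
theorem decomposable_sJNoetherian_iff_sNoetherian {R : Type*} [CommRing R] (S : Set R)
    (hS : MultClosed S) (J : Ideal R)
    (hdec : ∃ e : R, e * e = e ∧ e ≠ 0 ∧ e ≠ 1)
    (hJ : ∀ e : R, e * e = e → e ≠ 0 → e ≠ 1 →
      (fun x => e * x) '' (J : Set R) ≠ ((Ideal.span {e} : Ideal R) : Set R)) :
    SJNoetherian S J ↔ SNoetherian S := by
  refine ⟨fun h I => ?_, fun h I _ => h I⟩
  have component : ∀ e : R, e * e = e → e ≠ 0 → e ≠ 1 →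
      ∃ s ∈ S, ∃ F : Ideal R, F.FG ∧ (∀ x ∈ I, s * ((1 - e) * x) ∈ F) ∧ F ≤ I :=
    fun e he h0 h1 => SFinite.exists_fg_le_of_sup_span_idempotent he <| h _ fun hle =>
      hJ e he h0 h1 <| image_mul_eq_span_of_idempotent_mem he <|
        hle (Ideal.mem_sup_right (Ideal.mem_span_singleton_self e))
  obtain ⟨e, he, h0, h1⟩ := hdec
  obtain ⟨s, hs, F, hF, hsF, hFI⟩ := component e he h0 h1
  obtain ⟨t, ht, G, hG, htG, hGI⟩ := component (1 - e) (by linear_combination he)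
    (sub_ne_zero.2 h1.symm) (by simpa using h0)
  refine ⟨s * t, hS.2 s hs t ht, F ⊔ G, Submodule.FG.sup hF hG, fun x hx => ?_, sup_le hFI hGI⟩
  have hdecomp : s * t * x = t * (s * ((1 - e) * x)) + s * (t * ((1 - (1 - e)) * x)) := by
    ring
  rw [hdecomp]
  exact add_mem (Ideal.mem_sup_left (F.mul_mem_left t (hsF x hx)))
    (Ideal.mem_sup_right (G.mul_mem_left s (htG x hx)))
end

section
/- Let R be a commutative ring with identity, S ⊆ R a multiplicatively closed subset, and J an ideal of R. If R is S-J-Noetherian, then every S-irreducible J-ideal of R is S-primary. -/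
/-- An ideal `Q` disjoint from `S` is `S`-irreducible if whenever
`s(I ∩ K) ⊆ Q ⊆ I ∩ K` for some `s ∈ S` and ideals `I`, `K`, there is `s' ∈ S` with
`ss'I ⊆ Q` or `ss'K ⊆ Q`. -/
def SIrreducible {R : Type*} [CommRing R] (S : Set R) (Q : Ideal R) : Prop :=
  (Q : Set R) ∩ S = ∅ ∧
    ∀ s ∈ S, ∀ I K : Ideal R, (∀ x ∈ I ⊓ K, s * x ∈ Q) → Q ≤ I ⊓ K →
      ∃ s' ∈ S, (∀ x ∈ I, s * s' * x ∈ Q) ∨ (∀ x ∈ K, s * s' * x ∈ Q)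

/-- A proper ideal `Q` disjoint from `S` is `S`-primary if there is `s ∈ S` such that
`ab ∈ Q` implies `sa ∈ Q` or `sb ∈ rad Q`. -/
def SPrimary {R : Type*} [CommRing R] (S : Set R) (Q : Ideal R) : Prop :=
  Q ≠ ⊤ ∧ (Q : Set R) ∩ S = ∅ ∧
    ∃ s ∈ S, ∀ a b : R, a * b ∈ Q → s * a ∈ Q ∨ s * b ∈ Q.radical

/-- The saturation of the ideal `Q` with respect to a submonoid `M`: the elements that some
member of `M` multiplies into `Q`. -/
def Ideal.saturationAt {R : Type*} [CommRing R] (Q : Ideal R) (M : Submonoid R) : Ideal R where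
  carrier := {x | ∃ m ∈ M, m * x ∈ Q}
  zero_mem' := ⟨1, M.one_mem, by simp⟩
  add_mem' := by
    rintro x y ⟨m, hm, hx⟩ ⟨n, hn, hy⟩
    refine ⟨m * n, M.mul_mem hm hn, ?_⟩
    have h := Q.add_mem (Q.mul_mem_left n hx) (Q.mul_mem_left m hy)
    convert h using 1
    ring
  smul_mem' := by
    rintro c x ⟨m, hm, hx⟩
    refine ⟨m, hm, ?_⟩
    rw [smul_eq_mul, mul_left_comm]
    exact Q.mul_mem_left c hx

theorem Ideal.le_saturationAt {R : Type*} [CommRing R] (Q : Ideal R) (M : Submonoid R) :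
    Q ≤ Q.saturationAt M :=
  fun x hx => ⟨1, M.one_mem, by simpa using hx⟩

/-- A finitely generated ideal inside the saturation is multiplied into `Q` by a single
element of `M`. -/
theorem Ideal.exists_mul_mem_of_fg {R : Type*} [CommRing R] (Q : Ideal R) (M : Submonoid R)
    {F : Ideal R} (hF : F.FG) (hFQ : F ≤ Q.saturationAt M) :
    ∃ m ∈ M, ∀ x ∈ F, m * x ∈ Q := by
  induction F, hF using Submodule.fg_induction with
  | singleton x =>
    obtain ⟨m, hm, hx⟩ := hFQ (Submodule.mem_span_singleton_self x)
    refine ⟨m, hm, fun y hy => ?_⟩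
    obtain ⟨c, rfl⟩ := Submodule.mem_span_singleton.mp hy
    rw [smul_eq_mul, mul_left_comm]
    exact Q.mul_mem_left c hx
  | sup F G _ _ ihF ihG =>
    obtain ⟨m, hm, hmF⟩ := ihF (le_sup_left.trans hFQ)
    obtain ⟨n, hn, hnG⟩ := ihG (le_sup_right.trans hFQ)
    refine ⟨m * n, M.mul_mem hm hn, fun x hx => ?_⟩
    obtain ⟨y, hy, z, hz, rfl⟩ := Submodule.mem_sup.mp hx
    have h := Q.add_mem (Q.mul_mem_left n (hmF y hy)) (Q.mul_mem_left m (hnG z hz))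
    convert h using 1
    ring

/-- If the saturation of `Q` at `M` is `S`-finite, a single product of an element of `M` and an
element of `S` multiplies it into `Q`. -/
theorem SFinite.exists_mul_saturationAt_le {R : Type*} [CommRing R] {S : Set R} {Q : Ideal R}
    {M : Submonoid R} (h : SFinite S (Q.saturationAt M)) :
    ∃ m ∈ M, ∃ s ∈ S, ∀ x ∈ Q.saturationAt M, m * (s * x) ∈ Q := by
  obtain ⟨s, hs, F, hF, hsF, hFQ⟩ := h
  obtain ⟨m, hm, hmF⟩ := Q.exists_mul_mem_of_fg M hF hFQ
  exact ⟨m, hm, s, hs, fun x hx => hmF _ (hsF x hx)⟩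

/-- For an `S`-irreducible ideal, `ab ∈ Q` forces `a` or a power of `b` into `Q` up to a
multiplier from `S`, which may depend on `a` and `b`. -/
theorem SIrreducible.exists_mul_mem_or_mul_pow_mem {R : Type*} [CommRing R] {S : Set R}
    (hS : MultClosed S) {Q : Ideal R} (hQ : SIrreducible S Q) {a b : R}
    (hfin : SFinite S (Q.saturationAt (Submonoid.powers b))) (hab : a * b ∈ Q) :
    ∃ s ∈ S, s * a ∈ Q ∨ ∃ k : ℕ, s * b ^ k ∈ Q := by
  obtain ⟨_, ⟨k, rfl⟩, s, hs, hk⟩ := hfin.exists_mul_saturationAt_le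
  have hinf : ∀ x ∈ (Q ⊔ Ideal.span {b ^ k}) ⊓ (Q ⊔ Ideal.span {a}), s * x ∈ Q := by
    rintro x ⟨hxI, hxK⟩
    obtain ⟨q, hq, y, hy, rfl⟩ := Submodule.mem_sup.mp hxI
    obtain ⟨r, rfl⟩ := Ideal.mem_span_singleton'.mp hy
    obtain ⟨q', hq', z, hz, hxz⟩ := Submodule.mem_sup.mp hxK
    obtain ⟨t, rfl⟩ := Ideal.mem_span_singleton'.mp hz
    have hr : r ∈ Q.saturationAt (Submonoid.powers b) := by
      refine ⟨b ^ (k + 1), ⟨k + 1, rfl⟩, ?_⟩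
      have h := Q.sub_mem (Q.add_mem (Q.mul_mem_left b hq') (Q.mul_mem_left t hab))
        (Q.mul_mem_left b hq)
      convert h using 1
      linear_combination -b * hxz
    have h := Q.add_mem (Q.mul_mem_left s hq) (hk r hr)
    convert h using 1
    ring
  obtain ⟨s', hs', h⟩ := hQ.2 s hs (Q ⊔ Ideal.span {b ^ k}) (Q ⊔ Ideal.span {a}) hinf
    (le_inf le_sup_left le_sup_left)
  refine ⟨s * s', hS.2 s hs s' hs', ?_⟩
  rcases h with h | h
  · exact Or.inr ⟨k, h _ (Ideal.mem_sup_right (Ideal.mem_span_singleton_self _))⟩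
  · exact Or.inl (h _ (Ideal.mem_sup_right (Ideal.mem_span_singleton_self _)))

/-- If `R` is `S`-`J`-Noetherian, then every `S`-irreducible `J`-ideal of `R` is
`S`-primary. -/
theorem sIrreducible_is_sPrimary {R : Type*} [CommRing R] (S : Set R)
    (hS : MultClosed S) (J : Ideal R) (hSJ : SJNoetherian S J) (Q : Ideal R)
    (hQJ : ¬ Q ≤ J) (hQ : SIrreducible S Q) : SPrimary S Q := by
  obtain ⟨hS1, hSmul⟩ := id hS
  let M : Submonoid R :=
    { carrier := S, one_mem' := hS1, mul_mem' := fun {a b} ha hb => hSmul a ha b hb }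
  have hfin (N : Submonoid R) : SFinite S (Q.saturationAt N) :=
    hSJ _ fun h => hQJ ((Q.le_saturationAt N).trans h)
  have hne : Q ≠ ⊤ := by
    rintro rfl
    exact Set.eq_empty_iff_forall_notMem.mp hQ.1 1 ⟨trivial, hS1⟩
  obtain ⟨m, hm, s, hs, hw⟩ := (hfin M).exists_mul_saturationAt_le
  refine ⟨hne, hQ.1, m * s, hSmul m hm s hs, fun a b hab => ?_⟩
  obtain ⟨u, hu, ha | ⟨k, hb⟩⟩ := hQ.exists_mul_mem_or_mul_pow_mem hS (hfin _) hab
  · left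
    rw [mul_assoc]
    exact hw a ⟨u, hu, ha⟩
  · right
    refine ⟨k + 1, ?_⟩
    have h := Q.mul_mem_left ((m * s) ^ k * b) (hw _ ⟨u, hu, hb⟩)
    convert h using 1
    ring
end

section
/- Let R be a commutative ring with identity, S ⊆ R a multiplicatively closed subset, and J an ideal of R. If R is S-J-Noetherian, then every proper J-ideal I of R with I ∩ S = ∅ can be written as a finite intersection of S-primary ideals of R; that is, there exist n ≥ 1 and S-primary ideals Q₁, …, Qₙ of R with I = Q₁ ∩ ⋯ ∩ Qₙ. -/
/-- The multiplicatively closed subset `S` as a submonoid. -/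
def MultClosed.toSubmonoid {R : Type*} [CommRing R] {S : Set R} (hS : MultClosed S) :
    Submonoid R where
  carrier := S
  one_mem' := hS.1
  mul_mem' {a b} ha hb := hS.2 a ha b hb

/-- The ring `S⁻¹R / S⁻¹I`, described through its structure map from `R`. -/
theorem MultClosed.exists_localization_quotient.{u} {R : Type u} [CommRing R] {S : Set R}
    (hS : MultClosed S) (I : Ideal R) :
    ∃ (B : Type u) (_ : CommRing B) (f : R →+* B),
      (∀ s ∈ S, IsUnit (f s)) ∧ (∀ b, ∃ r, ∃ s ∈ S, b * f s = f r) ∧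
        ∀ x, f x = 0 ↔ ∃ s ∈ S, s * x ∈ I := by
  let M := hS.toSubmonoid
  let K := I.map (algebraMap R (Localization M))
  refine ⟨Localization M ⧸ K, inferInstance,
    (Ideal.Quotient.mk K).comp (algebraMap R (Localization M)), ?_, ?_, ?_⟩
  · intro s hs
    exact (IsLocalization.map_units (Localization M) (⟨s, hs⟩ : M)).map (Ideal.Quotient.mk K)
  · intro b
    obtain ⟨a, rfl⟩ := Ideal.Quotient.mk_surjective b
    obtain ⟨⟨r, s⟩, h⟩ := IsLocalization.surj M a
    exact ⟨r, s, s.2, by simp only [RingHom.comp_apply, ← map_mul]; rw [h]⟩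
  · intro x
    rw [RingHom.comp_apply, Ideal.Quotient.eq_zero_iff_mem]
    exact IsLocalization.algebraMap_mem_map_algebraMap_iff M (Localization M) I x

/-- If every ideal containing the ideal `I` is `S`-finite, then `S⁻¹R / S⁻¹I` is Noetherian. -/
theorem isNoetherianRing_of_sFinite {R B : Type*} [CommRing R] [CommRing B] {S : Set R}
    {I : Ideal R} (hfin : ∀ L : Ideal R, I ≤ L → SFinite S L) {f : R →+* B}
    (hunit : ∀ s ∈ S, IsUnit (f s)) (hsurj : ∀ b, ∃ r, ∃ s ∈ S, b * f s = f r)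
    (hI : ∀ x ∈ I, f x = 0) : IsNoetherianRing B := by
  refine isNoetherianRing_iff_ideal_fg B |>.2 fun K => ?_
  obtain ⟨s, hs, F, hF, hsF, hFK⟩ := hfin (K.comap f) fun x hx => by
    simp [Ideal.mem_comap, hI x hx]
  have : K = F.map f := by
    refine le_antisymm (fun b hb => ?_) (Ideal.map_le_iff_le_comap.2 hFK)
    obtain ⟨r, t, ht, h⟩ := hsurj b
    have hr : r ∈ K.comap f := by
      rw [Ideal.mem_comap, ← h]
      exact K.mul_mem_right _ hb
    have hm := Ideal.mem_map_of_mem f (hsF r hr)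
    rwa [map_mul, ← h, Ideal.unit_mul_mem_iff_mem _ (hunit s hs), mul_comm,
      Ideal.unit_mul_mem_iff_mem _ (hunit t ht)] at hm
  exact this ▸ hF.map f

/-- Intersecting a primary ideal disjoint from `S` with an ideal that meets `S` gives an
`S`-primary ideal. -/
theorem SPrimary.inf_of_isPrimary {R : Type*} [CommRing R] {S : Set R} {P T : Ideal R}
    (hP : P.IsPrimary) (hPS : ∀ x ∈ S, x ∉ P) {s : R} (hs : s ∈ S) (hsT : s ∈ T) :
    SPrimary S (P ⊓ T) := by
  refine ⟨fun h => hP.1 (top_le_iff.1 (h ▸ inf_le_left)), ?_, s, hs, fun a b hab => ?_⟩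
  · exact Set.eq_empty_of_forall_notMem fun x hx => hPS x hx.2 hx.1.1
  · refine ((Ideal.isPrimary_iff.1 hP).2 hab.1).imp
      (fun ha => ⟨P.mul_mem_left _ ha, T.mul_mem_right _ hsT⟩) fun hb => ?_
    rw [Ideal.radical_inf]
    exact ⟨Ideal.mul_mem_left _ _ hb, Ideal.mul_mem_right _ _ (Ideal.le_radical hsT)⟩

/-- If the saturation of `I` is the colon ideal `(I : s)`, then `I` is the intersection of its
saturation with `I + (s)`. -/
theorem Ideal.eq_inf_sup_span_singleton {R : Type*} [CommRing R] {I I' : Ideal R} {s : R}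
    (hle : I ≤ I') (hs : ∀ x ∈ I', s * x ∈ I) (hs' : ∀ x, s * s * x ∈ I → x ∈ I') :
    I = I' ⊓ (I ⊔ Ideal.span {s}) := by
  refine le_antisymm (le_inf hle le_sup_left) fun x ⟨hx, hxs⟩ => ?_
  obtain ⟨a, ha, b, hb, rfl⟩ := Submodule.mem_sup.1 hxs
  obtain ⟨r, rfl⟩ := Ideal.mem_span_singleton'.1 hb
  refine I.add_mem ha ?_
  rw [mul_comm]
  refine hs r (hs' r ?_)
  convert I.sub_mem (hs _ hx) (I.mul_mem_left s ha) using 1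
  ring

/-- Lasker–Noether for `S`-`J`-Noetherian rings: every proper `J`-ideal disjoint from
`S` is a finite intersection of `S`-primary ideals. -/
theorem sPrimary_decomposition {R : Type*} [CommRing R] (S : Set R)
    (hS : MultClosed S) (J : Ideal R) (hSJ : SJNoetherian S J) (I : Ideal R)
    (hItop : I ≠ ⊤) (hIJ : ¬ I ≤ J) (hIS : (I : Set R) ∩ S = ∅) :
    ∃ n : ℕ, 1 ≤ n ∧ ∃ Q : Fin n → Ideal R,
      (∀ i, SPrimary S (Q i)) ∧ I = ⨅ i, Q i := by
  obtain ⟨B, _, f, hunit, hsurj, hker⟩ := hS.exists_localization_quotient I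
  have hfin : ∀ L : Ideal R, I ≤ L → SFinite S L := fun L hL => hSJ L fun h => hIJ (hL.trans h)
  have hle : I ≤ RingHom.ker f := fun x hx => (hker x).2 ⟨1, hS.1, by simpa using hx⟩
  have := isNoetherianRing_of_sFinite hfin hunit hsurj hle
  obtain ⟨s, hs, hsker⟩ : ∃ s ∈ S, ∀ x ∈ RingHom.ker f, s * x ∈ I := by
    obtain ⟨t, ht, F, hF, htF, hFker⟩ := hfin _ hle
    obtain ⟨u, hu, huF⟩ : ∃ u ∈ S, ∀ x ∈ F, u * x ∈ I := by
      obtain ⟨G, rfl⟩ := hF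
      have hG : ∀ g ∈ G, ∃ u ∈ S, u * g ∈ I := fun g hg =>
        (hker g).1 (hFker (Ideal.subset_span hg))
      choose! v hvS hv using hG
      refine ⟨∏ g ∈ G, v g, hS.toSubmonoid.prod_mem hvS, fun x hx => ?_⟩
      suffices h : Ideal.span (G : Set R) ≤
          Submodule.comap (LinearMap.mulLeft R (∏ g ∈ G, v g)) I from h hx
      refine Ideal.span_le.2 fun g hg => ?_
      obtain ⟨c, hc⟩ := Finset.dvd_prod_of_mem v hg
      change (∏ g ∈ G, v g) * g ∈ I
      rw [hc, mul_right_comm]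
      exact I.mul_mem_right _ (hv g hg)
    exact ⟨u * t, hS.2 u hu t ht, fun x hx => by rw [mul_assoc]; exact huF _ (htF x hx)⟩
  have hI := Ideal.eq_inf_sup_span_singleton hle hsker fun x hx =>
    (hker x).2 ⟨s * s, hS.2 s hs s hs, hx⟩
  obtain ⟨A, hA, hprim⟩ := Submodule.isLasker B B ⊥
  let e := A.equivFin
  let P : Fin A.card → Ideal R := fun i => Ideal.comap f (e.symm i : Ideal B)
  have hP : RingHom.ker f = ⨅ i, P i := by
    ext x
    rw [RingHom.ker_eq_comap_bot, ← hA, Ideal.mem_comap, Submodule.mem_finsetInf, Ideal.mem_iInf]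
    exact ⟨fun h i => h _ (e.symm i).2, fun h K hK => by simpa [P] using h (e ⟨K, hK⟩)⟩
  have hcard : 1 ≤ A.card := by
    by_contra! h
    have : IsEmpty (Fin A.card) := by rw [Nat.lt_one_iff.1 h]; infer_instance
    have h1 : (1 : R) ∈ RingHom.ker f := by rw [hP, iInf_of_empty]; trivial
    have hsI := hsker 1 h1
    rw [mul_one] at hsI
    exact (Set.eq_empty_iff_forall_notMem.1 hIS s) ⟨hsI, hs⟩
  have : Nonempty (Fin A.card) := ⟨⟨0, hcard⟩⟩
  refine ⟨A.card, hcard, fun i => P i ⊓ (I ⊔ Ideal.span {s}), fun i => ?_, ?_⟩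
  · have hi := hprim (e.symm i).2
    refine SPrimary.inf_of_isPrimary (Ideal.IsPrimary.comap hi f) (fun x hx hxP => ?_) hs
      (Ideal.mem_sup_right (Ideal.mem_span_singleton_self s))
    exact hi.1 (Ideal.eq_top_of_isUnit_mem _ hxP (hunit x hx))
  · rw [← iInf_inf, ← hP]
    exact hI
end
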